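/- Let a, b, c, p ∈ ℂ with bc − p(a−p) ≠ 0, and set γ = p(a−p)(b+c−a)/(bc − p(a−p)). Assume none of 1+a−b, 1+a−c, p, a−p, γ is a nonpositive integer. Let x be a real number with −1 < x < 3 − 2√2. Then (both series converging absolutely, since |x| < 1 and 4|x| < (1−x)²): ₅F₄(a, b, c, a−p+1, p+1; 1+a−b, 1+a−c, p, a−p; x) = (1−x)^{−a} · ₄F₃(a/2, (a+1)/2, a−b−c, γ+1; 1+a−b, 1+a−c, γ; −4x/(1−x)²). -/

import Mathlib

/-- Rising factorial (Pochhammer symbol) `(a)ₖ = a(a+1)⋯(a+k−1)`. -/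
noncomputable def poch (a : ℂ) (k : ℕ) : ℂ := (ascPochhammer ℂ k).eval a

/-- The hypergeometric series `ₘFₗ(A; B; x)` (as a `tsum`). -/
noncomputable def hypF (A B : List ℂ) (x : ℂ) : ℂ :=
  ∑' k : ℕ, (A.map fun a => poch a k).prod /
      ((k.factorial : ℂ) * (B.map fun b => poch b k).prod) * x ^ k

/-- Absolute convergence (= summability in `ℂ`) of the hypergeometric series. -/
def hypSummable (A B : List ℂ) (x : ℂ) : Prop :=
  Summable fun k : ℕ => (A.map fun a => poch a k).prod /
      ((k.factorial : ℂ) * (B.map fun b => poch b k).prod) * x ^ k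

open Filter Topology

lemma poch_zero (a : ℂ) : poch a 0 = 1 := by simp [poch]

lemma poch_succ (a : ℂ) (k : ℕ) : poch a (k + 1) = poch a k * (a + k) :=
  ascPochhammer_succ_eval k a

lemma poch_add (a : ℂ) (m k : ℕ) : poch a (m + k) = poch a m * poch (a + m) k := by
  induction k with
  | zero => simp [poch_zero]
  | succ k ih =>
    rw [← add_assoc, poch_succ, ih, poch_succ]
    push_cast
    ring

lemma poch_ne_zero {z : ℂ} (hz : ∀ m : ℕ, z ≠ -(m : ℂ)) (k : ℕ) : poch z k ≠ 0 := by
  induction k with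
  | zero => simp [poch_zero]
  | succ k ih =>
    rw [poch_succ]
    exact mul_ne_zero ih fun h => hz k (eq_neg_of_add_eq_zero_left h)

lemma poch_neg_natCast_mul (n k : ℕ) :
    (n + 1 : ℂ) * poch (-n) k = poch (-(n + 1 : ℕ)) k * (n + 1 - k) := by
  induction k with
  | zero => simp [poch_zero]
  | succ k ih =>
    rw [poch_succ, poch_succ, ← mul_assoc, ih]
    push_cast
    ring

lemma poch_neg_natCast_of_lt {n k : ℕ} (h : n < k) : poch (-n) k = 0 := by
  obtain ⟨j, rfl⟩ := Nat.exists_eq_add_of_lt h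
  rw [show n + j + 1 = (n + 1) + j by ring, poch_add, poch_succ]
  simp

lemma poch_neg_natCast_add (k j : ℕ) :
    poch (-(j + k : ℕ)) k * (j.factorial : ℂ) = (-1) ^ k * ((j + k).factorial : ℂ) := by
  induction k generalizing j with
  | zero => simp [poch_zero]
  | succ k ih =>
    have h := ih (j + 1)
    rw [poch_succ, show j + (k + 1) = j + 1 + k by ring]
    rw [Nat.factorial_succ] at h
    push_cast at h ⊢
    rw [pow_succ]
    linear_combination -h

lemma poch_two_mul (a : ℂ) (k : ℕ) :
    poch a (2 * k) = 4 ^ k * poch (a / 2) k * poch ((a + 1) / 2) k := by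
  induction k with
  | zero => simp [poch_zero]
  | succ k ih =>
    rw [show 2 * (k + 1) = 2 * k + 1 + 1 by ring]
    simp only [poch_succ, ih]
    push_cast
    ring

lemma poch_add_one_mul (z : ℂ) (k : ℕ) : z * poch (z + 1) k = poch z k * (z + k) := by
  have h := poch_add z 1 k
  rw [add_comm 1 k, poch_succ] at h
  simpa [poch_succ, poch_zero] using h.symm

lemma norm_poch_le {a : ℂ} {s : ℝ} (h : ‖a‖ ≤ s) (k : ℕ) : ‖poch a k‖ ≤ ‖poch s k‖ := by
  induction k with
  | zero => simp [poch_zero]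
  | succ k ih =>
    have hs : 0 ≤ s := (norm_nonneg a).trans h
    rw [poch_succ, poch_succ, norm_mul, norm_mul, ← Complex.ofReal_natCast, ← Complex.ofReal_add,
      Complex.norm_real, Real.norm_of_nonneg (by positivity)]
    gcongr
    refine (norm_add_le _ _).trans ?_
    rw [Complex.norm_real, Real.norm_natCast]
    gcongr

lemma saalschutz_sum {a b c : ℂ} {e : ℕ → ℂ}
    (he : ∀ k : ℕ, (k + 1) * (1 + a - b + k) * (1 + a - c + k) * e (k + 1)
      = (a - b - c + 1 + k) * e k)
    (he0 : e 0 = 1) (hB : ∀ m : ℕ, 1 + a - b ≠ -(m : ℂ)) (hC : ∀ m : ℕ, 1 + a - c ≠ -(m : ℂ))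
    (n : ℕ) :
    ∑ k ∈ Finset.range (n + 1), poch (-n) k * poch a (n + k) * e k
      = poch a n * poch b n * poch c n / (poch (1 + a - b) n * poch (1 + a - c) n) := by
  induction n with
  | zero => simp [poch_zero, he0]
  | succ n ih =>
    have hn : (n + 1 : ℂ) ≠ 0 := by exact_mod_cast n.succ_ne_zero
    have key : ∀ m : ℕ, ∑ k ∈ Finset.range m,
        ((n + 1) * (1 + a - b + n) * (1 + a - c + n) *
            (poch (-(n + 1 : ℕ)) k * poch a (n + 1 + k) * e k)
          - (n + 1) * (a + n) * (b + n) * (c + n) * (poch (-n) k * poch a (n + k) * e k))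
        = -(2 * n + 1 + a) * m * (1 + a - b + m - 1) * (1 + a - c + m - 1) *
          (poch (-(n + 1 : ℕ)) m * poch a (n + m) * e m) := by
      intro m
      induction m with
      | zero => simp
      | succ m ihm =>
        rw [Finset.sum_range_succ, ihm, show n + 1 + m = n + m + 1 by ring,
          show n + (m + 1) = n + m + 1 by ring, poch_succ, poch_succ]
        have h1 := poch_neg_natCast_mul n m
        have h2 := he m
        push_cast at h1 h2 ⊢
        linear_combination
          (-(a + n) * (b + n) * (c + n) * (poch a (n + m) * e m)) * h1
          + (2 * n + 1 + a) * (poch (-(n + 1)) m * (-(n + 1) + m)) *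
            (poch a (n + m) * (a + (n + m))) * h2
    have h := key (n + 1 + 1)
    rw [poch_neg_natCast_of_lt (Nat.lt_succ_self (n + 1)), Finset.sum_sub_distrib,
      ← Finset.mul_sum, ← Finset.mul_sum, Finset.sum_range_succ (fun k => poch (-n) k * _ * _),
      poch_neg_natCast_of_lt (Nat.lt_succ_self n), ih] at h
    have hBn := poch_ne_zero hB n
    have hCn := poch_ne_zero hC n
    have hBn' := poch_ne_zero hB (n + 1)
    have hCn' := poch_ne_zero hC (n + 1)
    rw [eq_div_iff (mul_ne_zero hBn' hCn')]
    rw [poch_succ _ n] at hBn' hCn'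
    simp only [poch_succ _ n]
    simp only [zero_mul, mul_zero, add_zero] at h
    have hn' : (n + 1 : ℂ) * ((∑ k ∈ Finset.range (n + 1 + 1),
        poch (-(n + 1 : ℕ)) k * poch a (n + 1 + k) * e k) *
        (poch (1 + a - b) n * (1 + a - b + n) * (poch (1 + a - c) n * (1 + a - c + n))))
        = (n + 1) * (poch a n * (a + n) * (poch b n * (b + n)) * (poch c n * (c + n))) := by
      field_simp at h
      linear_combination h
    exact mul_left_cancel₀ hn hn'

lemma sum_poch_neg_mul_linear {a b c : ℂ} {v : ℕ → ℂ}
    (hv : ∀ k : ℕ, (k + 1) * (1 + a - b + k) * (1 + a - c + k) * v (k + 1)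
      = (a - b - c + k) * v k) (n : ℕ) :
    ∑ k ∈ Finset.range (n + 1), poch (-n) k * poch a (n + k) * v k *
      (b * c * k + n * (n + a) * (a - b - c + k)) = 0 := by
  have key : ∀ m : ℕ, ∑ k ∈ Finset.range m, poch (-n) k * poch a (n + k) * v k *
      (b * c * k + n * (n + a) * (a - b - c + k))
      = -m * (1 + a - b + m - 1) * (1 + a - c + m - 1) * (poch (-n) m * poch a (n + m) * v m) := by
    intro m
    induction m with
    | zero => simp
    | succ m ihm =>
      rw [Finset.sum_range_succ, ihm, show n + (m + 1) = n + m + 1 by ring, poch_succ, poch_succ]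
      have h2 := hv m
      push_cast
      linear_combination (poch (-n) m * (-n + m)) * (poch a (n + m) * (a + (n + m))) * h2
  rw [key, poch_neg_natCast_of_lt (Nat.lt_succ_self n)]
  simp

lemma sum_poch_neg_wellPoised {a b c p γ : ℂ}
    (hbc : b * c - p * (a - p) ≠ 0)
    (hγ : γ * (b * c - p * (a - p)) = p * (a - p) * (b + c - a))
    (hB : ∀ m : ℕ, 1 + a - b ≠ -(m : ℂ)) (hC : ∀ m : ℕ, 1 + a - c ≠ -(m : ℂ))
    (hG : ∀ m : ℕ, γ ≠ -(m : ℂ))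
    (hP : ∀ m : ℕ, p ≠ -(m : ℂ)) (hQ : ∀ m : ℕ, a - p ≠ -(m : ℂ)) (n : ℕ) :
    ∑ k ∈ Finset.range (n + 1), poch (-n) k * poch a (n + k) *
      (poch (a - b - c) k * poch (γ + 1) k /
        (k.factorial * (poch (1 + a - b) k * poch (1 + a - c) k * poch γ k)))
      = poch a n * poch b n * poch c n * poch (a - p + 1) n * poch (p + 1) n /
        (poch (1 + a - b) n * poch (1 + a - c) n * poch p n * poch (a - p) n) := by
  have hp : p ≠ 0 := by simpa using hP 0
  have hq : a - p ≠ 0 := by simpa using hQ 0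
  have hγ0 : γ ≠ 0 := by simpa using hG 0
  have hd : a - b - c ≠ 0 := by
    intro h
    have : γ * (b * c - p * (a - p)) = 0 := by
      rw [hγ]
      linear_combination -(p * (a - p)) * h
    simp_all
  have hB' := fun k => poch_ne_zero hB k
  have hC' := fun k => poch_ne_zero hC k
  have hG' := fun k => poch_ne_zero hG k
  have hBk : ∀ k : ℕ, 1 + a - b + k ≠ 0 := fun k h => hB k (eq_neg_of_add_eq_zero_left h)
  have hCk : ∀ k : ℕ, 1 + a - c + k ≠ 0 := fun k h => hC k (eq_neg_of_add_eq_zero_left h)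
  have hfac : ∀ k : ℕ, (k.factorial : ℂ) ≠ 0 := fun k => by exact_mod_cast k.factorial_ne_zero
  have hk1 : ∀ k : ℕ, (k + 1 : ℂ) ≠ 0 := fun k => by exact_mod_cast k.succ_ne_zero
  have hrec : ∀ (z : ℂ) (k : ℕ), (k + 1) * (1 + a - b + k) * (1 + a - c + k) *
      (poch z (k + 1) / ((k + 1).factorial * (poch (1 + a - b) (k + 1) * poch (1 + a - c) (k + 1))))
      = (z + k) * (poch z k / (k.factorial * (poch (1 + a - b) k * poch (1 + a - c) k))) := by
    intro z k
    have := hB' k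
    have := hC' k
    have := hBk k
    have := hCk k
    have := hfac k
    have := hk1 k
    rw [Nat.factorial_succ, poch_succ, poch_succ, poch_succ]
    push_cast
    field_simp
  have h1 := saalschutz_sum (e := fun k => poch (a - b - c + 1) k /
    (k.factorial * (poch (1 + a - b) k * poch (1 + a - c) k)))
    (hrec (a - b - c + 1)) (by simp [poch_zero]) hB hC n
  have h2 := sum_poch_neg_mul_linear (v := fun k => poch (a - b - c) k /
    (k.factorial * (poch (1 + a - b) k * poch (1 + a - c) k))) (hrec (a - b - c)) n
  have hterm : ∀ k : ℕ, p * (a - p) * (a - b - c) * (poch (-n) k * poch a (n + k) *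
      (poch (a - b - c) k * poch (γ + 1) k /
        (k.factorial * (poch (1 + a - b) k * poch (1 + a - c) k * poch γ k))))
      = (p * (a - p) + n * (n + a)) * (a - b - c) * (poch (-n) k * poch a (n + k) *
        (poch (a - b - c + 1) k / (k.factorial * (poch (1 + a - b) k * poch (1 + a - c) k))))
      - poch (-n) k * poch a (n + k) *
        (poch (a - b - c) k / (k.factorial * (poch (1 + a - b) k * poch (1 + a - c) k))) *
        (b * c * k + n * (n + a) * (a - b - c + k)) := by
    intro k
    have e1 := poch_add_one_mul (a - b - c) k
    have e2 : poch (γ + 1) k = poch γ k * (γ + k) / γ := by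
      rw [eq_div_iff hγ0, ← poch_add_one_mul, mul_comm]
    have e3 : poch (a - b - c + 1) k = poch (a - b - c) k * (a - b - c + k) / (a - b - c) := by
      rw [eq_div_iff hd, ← e1, mul_comm]
    have := hB' k
    have := hC' k
    have := hG' k
    have := hfac k
    rw [e2, e3]
    field_simp
    linear_combination (poch (-n) k * poch a (n + k) * poch (a - b - c) k * k) * hγ
  have hsum : p * (a - p) * (a - b - c) * ∑ k ∈ Finset.range (n + 1), poch (-n) k * poch a (n + k) *
      (poch (a - b - c) k * poch (γ + 1) k /
        (k.factorial * (poch (1 + a - b) k * poch (1 + a - c) k * poch γ k)))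
      = (p * (a - p) + n * (n + a)) * (a - b - c) * (poch a n * poch b n * poch c n /
        (poch (1 + a - b) n * poch (1 + a - c) n)) := by
    rw [Finset.mul_sum, Finset.sum_congr rfl fun k _ => hterm k, Finset.sum_sub_distrib,
      ← Finset.mul_sum, h1, h2, sub_zero]
  have e4 : poch (p + 1) n = poch p n * (p + n) / p := by
    rw [eq_div_iff hp, ← poch_add_one_mul, mul_comm]
  have e5 : poch (a - p + 1) n = poch (a - p) n * (a - p + n) / (a - p) := by
    rw [eq_div_iff hq, ← poch_add_one_mul, mul_comm]
  refine mul_left_cancel₀ (mul_ne_zero (mul_ne_zero hp hq) hd) (hsum.trans ?_)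
  have := hB' n
  have := hC' n
  have := poch_ne_zero hP n
  have := poch_ne_zero hQ n
  rw [e4, e5]
  field_simp
  ring

lemma hasSum_poch_div_factorial_mul_pow (s : ℂ) {x : ℂ} (hx : ‖x‖ < 1) :
    HasSum (fun j : ℕ => poch s j / j.factorial * x ^ j) ((1 - x) ^ (-s)) := by
  have h := (Complex.one_div_one_sub_cpow_hasFPowerSeriesOnBall_zero s).hasSum
    (y := x) (by simpa [enorm_eq_nnnorm, ← NNReal.coe_lt_coe] using hx)
  rw [zero_add, one_div, ← Complex.cpow_neg] at h
  refine (congrArg (HasSum · _) (funext fun j => ?_)).mpr h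
  rw [FormalMultilinearSeries.ofScalars_apply_eq, smul_eq_mul]
  congr 1
  have h2 := Ring.factorial_nsmul_multichoose_eq_ascPochhammer s j
  rw [Polynomial.ascPochhammer_smeval_eq_eval, nsmul_eq_mul] at h2
  rw [poch, ← h2, Ring.choose, show s + j - 1 - j + 1 = s by ring, mul_div_cancel_left₀]
  exact_mod_cast j.factorial_ne_zero

lemma hasSum_norm_poch_div_factorial_mul_pow {s t : ℝ} (hs : 0 ≤ s) (ht0 : 0 ≤ t) (ht : t < 1) :
    HasSum (fun j : ℕ => ‖poch s j‖ / j.factorial * t ^ j) ((1 - t) ^ (-s)) := by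
  have h := hasSum_poch_div_factorial_mul_pow (s : ℂ) (x := (t : ℂ))
    (by rwa [Complex.norm_real, Real.norm_of_nonneg ht0])
  have hp : ∀ j : ℕ, poch s j = (‖poch s j‖ : ℝ) := by
    intro j
    induction j with
    | zero => simp [poch_zero]
    | succ j ih =>
      rw [poch_succ, norm_mul, ← Complex.ofReal_natCast, ← Complex.ofReal_add, Complex.norm_real,
        Real.norm_of_nonneg (by positivity), Complex.ofReal_mul, ← ih]
  rw [← Complex.hasSum_ofReal, Complex.ofReal_cpow (by linarith)]
  push_cast
  convert h using 4 with j
  exact (hp j).symm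

lemma tsum_sum_poch_neg_mul_pow {a x : ℂ} {E : ℕ → ℂ} (hx : ‖x‖ < 1)
    (hE : Summable fun k : ℕ => ‖poch a (2 * k) * E k‖ * (‖x‖ / (1 - ‖x‖) ^ 2) ^ k) :
    ∑' n : ℕ, (∑ k ∈ Finset.range (n + 1), poch (-n) k * poch a (n + k) * E k) / n.factorial * x ^ n
      = (1 - x) ^ (-a) * ∑' k : ℕ, poch a (2 * k) * E k * (-x / (1 - x) ^ 2) ^ k := by
  have hx0 : 1 - x ≠ 0 := by
    intro h
    rw [← sub_eq_zero.1 h] at hx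
    simp at hx
  set F : ℕ → ℕ → ℂ := fun k n => poch (-n) k * poch a (n + k) * E k / n.factorial * x ^ n with hF
  have hFlt : ∀ k, ∀ n ∉ Set.range (fun j : ℕ => j + k), F k n = 0 := by
    intro k n hn
    have : n < k := by
      by_contra! h
      exact hn ⟨n - k, by simp [h]⟩
    simp [hF, poch_neg_natCast_of_lt this]
  have hFadd : ∀ k j, F k (j + k) = poch a (2 * k) * E k * (-x) ^ k *
      (poch (a + (2 * k : ℕ)) j / j.factorial * x ^ j) := by
    intro k j
    have h1 := poch_neg_natCast_add k j
    have h2 := poch_add a (2 * k) j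
    have hj : (j.factorial : ℂ) ≠ 0 := by exact_mod_cast j.factorial_ne_zero
    have hjk : ((j + k).factorial : ℂ) ≠ 0 := by exact_mod_cast (j + k).factorial_ne_zero
    have h1' : poch (-(j + k : ℕ)) k = (-1) ^ k * ((j + k).factorial : ℂ) / j.factorial := by
      rw [eq_div_iff hj, h1]
    simp only [hF]
    rw [show j + k + k = 2 * k + j by ring, h2, h1', pow_add, neg_pow x]
    field_simp
  have hrow : ∀ k, HasSum (F k) ((1 - x) ^ (-a) *
      (poch a (2 * k) * E k * (-x / (1 - x) ^ 2) ^ k)) := by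
    intro k
    rw [← (add_left_injective k).hasSum_iff (hFlt k)]
    have h := (hasSum_poch_div_factorial_mul_pow (a + (2 * k : ℕ)) hx).mul_left
      (poch a (2 * k) * E k * (-x) ^ k)
    have hval : poch a (2 * k) * E k * (-x) ^ k * (1 - x) ^ (-(a + (2 * k : ℕ)))
        = (1 - x) ^ (-a) * (poch a (2 * k) * E k * (-x / (1 - x) ^ 2) ^ k) := by
      rw [neg_add, Complex.cpow_add _ _ hx0, Complex.cpow_neg _ ((2 * k : ℕ) : ℂ),
        Complex.cpow_natCast, div_pow, pow_mul]
      ring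
    rw [hval] at h
    exact (congrArg (HasSum · _) (funext fun j => hFadd k j)).mpr h
  have hnorm : ∀ k, Summable (fun n => ‖F k n‖) ∧ ∑' n, ‖F k n‖ ≤ (1 - ‖x‖) ^ (-‖a‖) *
      (‖poch a (2 * k) * E k‖ * (‖x‖ / (1 - ‖x‖) ^ 2) ^ k) := by
    intro k
    have hpos : 0 < 1 - ‖x‖ := by linarith
    have h := (hasSum_norm_poch_div_factorial_mul_pow (s := ‖a‖ + (2 * k : ℕ)) (by positivity)
      (norm_nonneg x) hx).mul_left (‖poch a (2 * k) * E k‖ * ‖x‖ ^ k)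
    have hval : ‖poch a (2 * k) * E k‖ * ‖x‖ ^ k * (1 - ‖x‖) ^ (-(‖a‖ + (2 * k : ℕ)))
        = (1 - ‖x‖) ^ (-‖a‖) * (‖poch a (2 * k) * E k‖ * (‖x‖ / (1 - ‖x‖) ^ 2) ^ k) := by
      rw [neg_add, Real.rpow_add hpos, Real.rpow_neg hpos.le ((2 * k : ℕ) : ℝ),
        Real.rpow_natCast, div_pow, pow_mul]
      ring
    rw [hval] at h
    have hle : ∀ j, ‖F k (j + k)‖ ≤ ‖poch a (2 * k) * E k‖ * ‖x‖ ^ k *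
        (‖poch ((‖a‖ + (2 * k : ℕ) : ℝ) : ℂ) j‖ / j.factorial * ‖x‖ ^ j) := by
      intro j
      rw [hFadd, norm_mul, norm_mul _ ((-x) ^ k), norm_pow, norm_neg, norm_mul _ (x ^ j), norm_div,
        norm_pow, Complex.norm_natCast]
      gcongr
      refine norm_poch_le ((norm_add_le _ _).trans_eq ?_) j
      rw [Complex.norm_natCast]
    have hs := Summable.of_nonneg_of_le (fun _ => norm_nonneg _) hle h.summable
    have hz : ∀ n ∉ Set.range (fun j : ℕ => j + k), ‖F k n‖ = 0 := fun n hn => by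
      rw [hFlt k n hn, norm_zero]
    have hs' := ((add_left_injective k).hasSum_iff (f := fun n => ‖F k n‖) hz).1 hs.hasSum
    refine ⟨hs'.summable, ?_⟩
    rw [hs'.tsum_eq]
    exact hasSum_le hle hs.hasSum h
  have hsum : Summable (Function.uncurry F) := by
    refine Summable.of_norm ?_
    rw [summable_prod_of_nonneg fun _ => norm_nonneg _]
    refine ⟨fun k => (hnorm k).1, ?_⟩
    exact Summable.of_nonneg_of_le (fun k => tsum_nonneg fun n => norm_nonneg _)
      (fun k => (hnorm k).2) (hE.mul_left _)
  have hcol : ∀ n, ∑' k, F k n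
      = (∑ k ∈ Finset.range (n + 1), poch (-n) k * poch a (n + k) * E k) / n.factorial * x ^ n := by
    intro n
    rw [tsum_eq_sum (s := Finset.range (n + 1)), Finset.sum_div, Finset.sum_mul]
    intro k hk
    have : n < k := by simpa using hk
    simp [hF, poch_neg_natCast_of_lt this]
  rw [← tsum_mul_left, ← tsum_congr fun k => (hrow k).tsum_eq, ← tsum_congr hcol]
  exact hsum.tsum_comm

/-- The coefficient of `x ^ k` in the hypergeometric series with parameters `A`, `B`. -/
noncomputable def hypCoeff (A B : List ℂ) (k : ℕ) : ℂ :=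
  (A.map fun a => poch a k).prod / ((k.factorial : ℂ) * (B.map fun b => poch b k).prod)

lemma prod_map_poch_succ (A : List ℂ) (k : ℕ) :
    (A.map fun a => poch a (k + 1)).prod
      = (A.map fun a => poch a k).prod * (A.map fun a => a + (k : ℂ)).prod := by
  simp only [poch_succ, List.prod_map_mul]

lemma hypCoeff_succ (A B : List ℂ) (k : ℕ) :
    hypCoeff A B (k + 1) = hypCoeff A B k *
      ((A.map fun a => a + (k : ℂ)).prod / ((k + 1) * (B.map fun b => b + (k : ℂ)).prod)) := by
  rw [hypCoeff, hypCoeff, prod_map_poch_succ, prod_map_poch_succ, Nat.factorial_succ]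
  push_cast
  rw [div_mul_div_comm]
  congr 1
  ring

lemma tendsto_prod_map_add_div (A : List ℂ) :
    Tendsto (fun n : ℕ => (A.map fun a => a + (n : ℂ)).prod / (n + 1 : ℂ) ^ A.length)
      atTop (𝓝 1) := by
  induction A with
  | nil => simp
  | cons z A ih =>
    have h1 : Tendsto (fun n : ℕ => (z + n) / (n + 1 : ℂ)) atTop (𝓝 1) := by
      have h := (tendsto_one_div_add_atTop_nhds_zero_nat (𝕜 := ℂ)).const_mul (z - 1)
      have h' := h.const_add 1
      rw [mul_zero, add_zero] at h'
      refine h'.congr fun n => ?_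
      have : (n + 1 : ℂ) ≠ 0 := by exact_mod_cast n.succ_ne_zero
      field_simp
      ring
    have h := h1.mul ih
    rw [one_mul] at h
    refine h.congr fun n => ?_
    rw [List.map_cons, List.prod_cons, List.length_cons, pow_succ', div_mul_div_comm]

lemma summable_hypCoeff {A B : List ℂ} (hAB : A.length = B.length + 1) {x : ℂ} (hx : ‖x‖ < 1) :
    Summable fun k : ℕ => hypCoeff A B k * x ^ k := by
  obtain ⟨r, hxr, hr⟩ := exists_between hx
  have hlim : Tendsto (fun k : ℕ => ‖(A.map fun a => a + (k : ℂ)).prod /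
      ((k + 1) * (B.map fun b => b + (k : ℂ)).prod) * x‖) atTop (𝓝 ‖x‖) := by
    have h := (((tendsto_prod_map_add_div A).div (tendsto_prod_map_add_div B)
      one_ne_zero).mul_const x).norm
    rw [div_one, one_mul] at h
    refine h.congr fun k => ?_
    have : (k + 1 : ℂ) ≠ 0 := by exact_mod_cast k.succ_ne_zero
    simp only [Pi.div_apply]
    rw [hAB, pow_succ, div_div_div_eq, mul_comm _ ((k + 1 : ℂ) ^ _), mul_assoc,
      mul_div_mul_left _ _ (pow_ne_zero _ this)]
  refine summable_of_ratio_norm_eventually_le hr ?_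
  filter_upwards [hlim.eventually_le_const hxr] with k hk
  rw [hypCoeff_succ, pow_succ, mul_mul_mul_comm, norm_mul, mul_comm]
  gcongr

lemma differentiableOn_hypF {A B : List ℂ} (hAB : A.length = B.length + 1) :
    DifferentiableOn ℂ (hypF A B) (Metric.ball 0 1) := by
  intro z hz
  obtain ⟨r, hzr, hr⟩ := exists_between (mem_ball_zero_iff.1 hz)
  have hr0 : 0 ≤ r := (norm_nonneg z).trans hzr.le
  have hs := (summable_hypCoeff hAB (x := (r : ℂ))
    (by rwa [Complex.norm_real, Real.norm_of_nonneg hr0])).norm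
  have h : DifferentiableOn ℂ (fun w => ∑' k : ℕ, hypCoeff A B k * w ^ k) (Metric.ball 0 r) := by
    refine Complex.differentiableOn_tsum_of_summable_norm hs (fun k => by fun_prop)
      Metric.isOpen_ball fun k w hw => ?_
    rw [norm_mul, norm_mul, norm_pow, norm_pow, Complex.norm_real, Real.norm_of_nonneg hr0]
    have := (mem_ball_zero_iff.1 hw).le
    gcongr
  exact (h.differentiableAt (Metric.isOpen_ball.mem_nhds
    (mem_ball_zero_iff.2 hzr))).differentiableWithinAt

lemma analyticAt_hypF {A B : List ℂ} (hAB : A.length = B.length + 1) {z : ℂ} (hz : ‖z‖ < 1) :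
    AnalyticAt ℂ (hypF A B) z :=
  (differentiableOn_hypF hAB).analyticAt
    (Metric.isOpen_ball.mem_nhds (mem_ball_zero_iff.2 hz))

lemma hypF_eq_of_norm_lt {a b c p γ x : ℂ}
    (hbc : b * c - p * (a - p) ≠ 0)
    (hγ : γ * (b * c - p * (a - p)) = p * (a - p) * (b + c - a))
    (hB : ∀ m : ℕ, 1 + a - b ≠ -(m : ℂ)) (hC : ∀ m : ℕ, 1 + a - c ≠ -(m : ℂ))
    (hG : ∀ m : ℕ, γ ≠ -(m : ℂ))
    (hP : ∀ m : ℕ, p ≠ -(m : ℂ)) (hQ : ∀ m : ℕ, a - p ≠ -(m : ℂ)) (hx : ‖x‖ < 1 / 8) :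
    hypF [a, b, c, a - p + 1, p + 1] [1 + a - b, 1 + a - c, p, a - p] x
      = (1 - x) ^ (-a) *
        hypF [a / 2, (a + 1) / 2, a - b - c, γ + 1] [1 + a - b, 1 + a - c, γ]
          (-4 * x / (1 - x) ^ 2) := by
  set E : ℕ → ℂ := fun k => poch (a - b - c) k * poch (γ + 1) k /
    (k.factorial * (poch (1 + a - b) k * poch (1 + a - c) k * poch γ k)) with hE
  have hcoeff : ∀ k (y : ℂ), hypCoeff [a / 2, (a + 1) / 2, a - b - c, γ + 1]
      [1 + a - b, 1 + a - c, γ] k * (4 * y) ^ k = poch a (2 * k) * E k * y ^ k := by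
    intro k y
    rw [poch_two_mul, mul_pow]
    simp only [hypCoeff, hE, List.map_cons, List.map_nil, List.prod_cons, List.prod_nil, mul_one]
    ring
  have hy : 4 * (‖x‖ / (1 - ‖x‖) ^ 2) < 1 := by
    have : 0 < 1 - ‖x‖ := by linarith
    rw [mul_div_assoc', div_lt_one (by positivity)]
    nlinarith [norm_nonneg x]
  have hy0 : 0 ≤ ‖x‖ / (1 - ‖x‖) ^ 2 := by positivity
  have hsum := (summable_hypCoeff (A := [a / 2, (a + 1) / 2, a - b - c, γ + 1])
    (B := [1 + a - b, 1 + a - c, γ]) rfl (x := 4 * ((‖x‖ / (1 - ‖x‖) ^ 2 : ℝ) : ℂ)) (by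
      rwa [norm_mul, Complex.norm_real, Real.norm_of_nonneg hy0, Complex.norm_ofNat])).norm
  simp only [hcoeff, norm_mul _ (_ ^ _), norm_pow, Complex.norm_real, Real.norm_of_nonneg hy0]
    at hsum
  have h := tsum_sum_poch_neg_mul_pow (hx.trans (by norm_num)) hsum
  have hl : ∀ n : ℕ, (∑ k ∈ Finset.range (n + 1), poch (-n) k * poch a (n + k) * E k) /
      n.factorial * x ^ n = hypCoeff [a, b, c, a - p + 1, p + 1]
        [1 + a - b, 1 + a - c, p, a - p] n * x ^ n := by
    intro n
    rw [sum_poch_neg_wellPoised hbc hγ hB hC hG hP hQ]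
    simp only [hypCoeff, List.map_cons, List.map_nil, List.prod_cons, List.prod_nil, mul_one]
    ring
  have hr : -4 * x / (1 - x) ^ 2 = 4 * (-x / (1 - x) ^ 2) := by ring
  rw [tsum_congr hl, ← tsum_congr fun k => hcoeff k _, ← hr] at h
  exact h

lemma norm_neg_four_mul_div_lt_one {x : ℝ} (hx1 : -1 < x) (hx2 : x < 3 - 2 * √2) :
    ‖-4 * (x : ℂ) / (1 - (x : ℂ)) ^ 2‖ < 1 := by
  have h2 : √2 ^ 2 = 2 := Real.sq_sqrt (by norm_num)
  have h1 : 1 < √2 := Real.lt_sqrt_of_sq_lt (by norm_num)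
  have hlt : 0 < 1 - x := by linarith
  rw [show -4 * (x : ℂ) / (1 - (x : ℂ)) ^ 2 = ((-4 * x / (1 - x) ^ 2 : ℝ) : ℂ) by push_cast; rfl,
    Complex.norm_real, Real.norm_eq_abs, abs_lt, lt_div_iff₀ (by positivity),
    div_lt_one (by positivity)]
  constructor <;> nlinarith

theorem corollary_1C6P1 (a b c p : ℂ)
    (hbc : b * c - p * (a - p) ≠ 0) (γ : ℂ)
    (hγ : γ = p * (a - p) * (b + c - a) / (b * c - p * (a - p)))
    (hnd : ∀ z ∈ [1 + a - b, 1 + a - c, p, a - p, γ], ∀ m : ℕ, z ≠ -(m : ℂ))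
    (x : ℝ) (hx1 : -1 < x) (hx2 : x < 3 - 2 * Real.sqrt 2) :
    hypSummable [a, b, c, a - p + 1, p + 1] [1 + a - b, 1 + a - c, p, a - p] (x : ℂ) ∧
    hypSummable [a / 2, (a + 1) / 2, a - b - c, γ + 1] [1 + a - b, 1 + a - c, γ]
        (-4 * (x : ℂ) / (1 - (x : ℂ)) ^ 2) ∧
    hypF [a, b, c, a - p + 1, p + 1] [1 + a - b, 1 + a - c, p, a - p] (x : ℂ)
      = (1 - (x : ℂ)) ^ (-a) *
        hypF [a / 2, (a + 1) / 2, a - b - c, γ + 1] [1 + a - b, 1 + a - c, γ]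
          (-4 * (x : ℂ) / (1 - (x : ℂ)) ^ 2) := by
  have hs : 1 < √2 := Real.lt_sqrt_of_sq_lt (by norm_num)
  have hs' : √2 < 3 / 2 := (Real.sqrt_lt' (by norm_num)).2 (by norm_num)
  have hnorm : ∀ y ∈ Set.Ioo (-1) (3 - 2 * √2), ‖(y : ℂ)‖ < 1 := fun y hy => by
    rw [Complex.norm_real, Real.norm_eq_abs, abs_lt]
    exact ⟨hy.1, by linarith [hy.2]⟩
  have hx : x ∈ Set.Ioo (-1) (3 - 2 * √2) := ⟨hx1, hx2⟩
  refine ⟨summable_hypCoeff rfl (hnorm x hx),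
    summable_hypCoeff rfl (norm_neg_four_mul_div_lt_one hx1 hx2), ?_⟩
  have hl : AnalyticOnNhd ℝ (fun y : ℝ =>
      hypF [a, b, c, a - p + 1, p + 1] [1 + a - b, 1 + a - c, p, a - p] (y : ℂ))
      (Set.Ioo (-1) (3 - 2 * √2)) := fun y hy =>
    (analyticAt_hypF rfl (hnorm y hy)).restrictScalars.comp (Complex.ofRealCLM.analyticAt y)
  have hr : AnalyticOnNhd ℝ (fun y : ℝ => (1 - (y : ℂ)) ^ (-a) *
        hypF [a / 2, (a + 1) / 2, a - b - c, γ + 1] [1 + a - b, 1 + a - c, γ]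
          (-4 * (y : ℂ) / (1 - (y : ℂ)) ^ 2)) (Set.Ioo (-1) (3 - 2 * √2)) := by
    intro y hy
    have hpos : 0 < 1 - y := by linarith [hy.2]
    have hne : (1 - (y : ℂ)) ≠ 0 := by exact_mod_cast hpos.ne'
    have hslit : 1 - (y : ℂ) ∈ Complex.slitPlane := Or.inl (by simpa using hpos)
    have h1 : AnalyticAt ℂ (fun z : ℂ => (1 - z) ^ (-a)) (y : ℂ) :=
      (analyticAt_const.sub analyticAt_id).cpow analyticAt_const hslit
    have h2 : AnalyticAt ℂ (fun z : ℂ => -4 * z / (1 - z) ^ 2) (y : ℂ) :=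
      (analyticAt_const.mul analyticAt_id).div ((analyticAt_const.sub analyticAt_id).pow 2)
        (pow_ne_zero 2 hne)
    have h3 := (analyticAt_hypF (A := [a / 2, (a + 1) / 2, a - b - c, γ + 1])
      (B := [1 + a - b, 1 + a - c, γ]) rfl
      (norm_neg_four_mul_div_lt_one hy.1 hy.2)).comp_of_eq h2 rfl
    exact (h1.mul h3).restrictScalars.comp (Complex.ofRealCLM.analyticAt y)
  refine hl.eqOn_of_preconnected_of_eventuallyEq hr isPreconnected_Ioo (z₀ := 0)
    ⟨by norm_num, by linarith⟩ ?_ hx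
  filter_upwards [Metric.ball_mem_nhds (0 : ℝ) (ε := 1 / 8) (by norm_num)] with y hy
  refine hypF_eq_of_norm_lt hbc (by rw [hγ, div_mul_cancel₀ _ hbc]) (hnd _ (by simp))
    (hnd _ (by simp)) (hnd _ (by simp)) (hnd _ (by simp)) (hnd _ (by simp)) ?_
  rw [Complex.norm_real]
  exact mem_ball_zero_iff.1 hy
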